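/- Let Σ be a set of N pairwise distinct complex numbers and let A ⊆ Σ be a subset with |A| = a. Then θ_{A,Σ∖A} := Σ_{α ∈ P(a,N−a)} (−1)^{|α̂^t|} s_α(A) · s_{α̂^t}(Σ∖A) equals Π_{λ∈A, μ∈Σ∖A} (λ − μ); in particular θ_{A,Σ∖A} ≠ 0. -/

import Mathlib

open Finset

/-- Complete homogeneous symmetric polynomial `h_k` of a tuple
(sum of all monomials of degree `k`). -/
noncomputable def hh {R : Type*} [CommRing R] {n : ℕ} (A : Fin n → R) (k : ℕ) : R :=
  ∑ c ∈ Finset.Nat.antidiagonalTuple n k, ∏ i, A i ^ c i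

/-- Elementary symmetric polynomial `e_k` of a tuple. -/
noncomputable def ee {R : Type*} [CommRing R] {n : ℕ} (A : Fin n → R) (k : ℕ) : R :=
  ∑ s ∈ Finset.powersetCard k (Finset.univ : Finset (Fin n)), ∏ i ∈ s, A i

/-- `h` with integer index, vanishing for negative index. -/
noncomputable def hZ {R : Type*} [CommRing R] {n : ℕ} (A : Fin n → R) (k : ℤ) : R :=
  if 0 ≤ k then hh A k.toNat else 0

/-- The Schur polynomial of a partition `α` with at most `ℓ` parts, evaluated at a
tuple, defined via the Jacobi–Trudi formula `s_α = det (h_{α_i + j - i})`. -/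
noncomputable def schur {R : Type*} [CommRing R] {n ℓ : ℕ} (A : Fin n → R)
    (α : Fin ℓ → ℕ) : R :=
  Matrix.det (Matrix.of fun i j : Fin ℓ => hZ A ((α i : ℤ) + (j : ℕ) - (i : ℕ)))

/-- `P(a,b)`: partitions with at most `a` parts, each of size at most `b`,
recorded as weakly decreasing functions `Fin a → ℕ` with values `≤ b`. -/
def box (a b : ℕ) : Finset (Fin a → ℕ) :=
  ((Finset.univ : Finset (Fin a → Fin (b + 1))).image fun f i => ((f i : ℕ))).filter
    fun α => ∀ i j : Fin a, i ≤ j → α j ≤ α i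

/-- The transpose of a partition with at most `a` parts, recorded with `b` parts:
`(α^t)_j = #{i | α_i > j}` (0-indexed). -/
def tr {a : ℕ} (b : ℕ) (α : Fin a → ℕ) : Fin b → ℕ :=
  fun j => (Finset.univ.filter fun i : Fin a => (j : ℕ) < α i).card

/-- The complement `α̂` of a partition `α ∈ P(a,b)` inside the `a × b` box:
`α̂_{a+1-j} = b - α_j`. -/
def boxCompl {a : ℕ} (b : ℕ) (α : Fin a → ℕ) : Fin a → ℕ :=
  fun i => b - α i.rev

/-- `α̂^t ∈ P(b,a)`: the transpose of the complement of `α ∈ P(a,b)`. -/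
def compTr (a b : ℕ) (α : Fin a → ℕ) : Fin b → ℕ :=
  tr b (boxCompl b α)

/-- The number of boxes `|α|` of a partition. -/
def wt {a : ℕ} (α : Fin a → ℕ) : ℕ := ∑ i, α i

/-- The elements of a finite set of complex numbers, listed as a tuple
(in some fixed order; symmetric polynomial evaluations do not depend on it). -/
noncomputable def ftuple {α : Type*} (A : Finset α) : Fin A.card → α :=
  fun i => (A.equivFin.symm i : α)

/-- `θ_{A,Σ∖A} = Σ_{α ∈ P(a,N−a)} (−1)^{|α̂^t|} s_α(A) · s_{α̂^t}(Σ∖A)`. -/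
noncomputable def theta (N a : ℕ) (S A : Finset ℂ) : ℂ :=
  ∑ α ∈ box a (N - a),
    (-1 : ℂ) ^ wt (compTr a (N - a) α) * schur (ftuple A) α *
      schur (ftuple (S \ A)) (compTr a (N - a) α)


lemma gen_hh {R : Type*} [CommRing R] {n : ℕ} (A : Fin n → R) :
    PowerSeries.mk (hh A) = ∏ i, PowerSeries.mk (fun m => A i ^ m) := by
  classical
  ext d
  rw [PowerSeries.coeff_prod, PowerSeries.coeff_mk, hh]
  refine Finset.sum_bij' (fun c _ => Finsupp.equivFunOnFinite.symm c) (fun c _ => ⇑c) ?_ ?_ ?_ ?_ ?_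
  · intro c hc
    rw [Finset.Nat.mem_antidiagonalTuple] at hc
    simp [Finset.mem_finsuppAntidiag, hc]
  · intro c hc
    rw [Finset.mem_finsuppAntidiag] at hc
    rw [Finset.Nat.mem_antidiagonalTuple]
    exact hc.1
  · intro c hc; rfl
  · intro c hc; ext; rfl
  · intro c hc
    simp

/-- The polynomial `∏_{l ≠ k} (1 - A_l t)`. -/
noncomputable def wpoly {R : Type*} [CommRing R] {n : ℕ} (A : Fin n → R) (k : Fin n) :
    Polynomial R := ∏ l ∈ Finset.univ.erase k, (1 - Polynomial.C (A l) * Polynomial.X)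

lemma geom_mul {R : Type*} [CommRing R] (x : R) :
    PowerSeries.mk (fun m => x ^ m) * (1 - PowerSeries.C x * PowerSeries.X) = 1 := by
  ext d
  rw [mul_sub, mul_one, map_sub, PowerSeries.coeff_mk, mul_comm (PowerSeries.C x), ← mul_assoc]
  rcases d with _ | d
  · simp
  · simp [PowerSeries.coeff_succ_mul_X, PowerSeries.coeff_mul_C, PowerSeries.coeff_one, pow_succ]

lemma gen_wpoly {R : Type*} [CommRing R] {n : ℕ} (A : Fin n → R) (k : Fin n) :
    PowerSeries.mk (hh A) * (wpoly A k : PowerSeries R) = PowerSeries.mk (fun m => A k ^ m) := by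
  have hw : (wpoly A k : PowerSeries R) =
      ∏ l ∈ Finset.univ.erase k, (1 - PowerSeries.C (A l) * PowerSeries.X) := by
    rw [wpoly, ← Polynomial.coeToPowerSeries.ringHom_apply, map_prod]
    simp [Polynomial.coeToPowerSeries.ringHom_apply]
  rw [gen_hh, hw, ← Finset.mul_prod_erase Finset.univ _ (Finset.mem_univ k), mul_assoc,
    ← Finset.prod_mul_distrib]
  simp only [geom_mul, Finset.prod_const_one, mul_one]

lemma wpoly_natDegree {R : Type*} [CommRing R] {n : ℕ} (A : Fin n → R) (k : Fin n) :
    (wpoly A k).natDegree < n := by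
  have h1 : (wpoly A k).natDegree ≤ ∑ l ∈ Finset.univ.erase k, 1 := by
    refine (Polynomial.natDegree_prod_le _ _).trans (Finset.sum_le_sum fun l _ => ?_)
    compute_degree
  have h2 := k.pos
  simp at h1
  omega

lemma pow_eq_sum {R : Type*} [CommRing R] {n : ℕ} (A : Fin n → R) (k : Fin n) (m : ℕ) :
    A k ^ m = ∑ c : Fin n, hZ A ((m : ℤ) - (c : ℕ)) * (wpoly A k).coeff c := by
  have h := congrArg (PowerSeries.coeff m) (gen_wpoly A k)
  rw [PowerSeries.coeff_mk, PowerSeries.coeff_mul] at h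
  rw [← h, ← Finset.Nat.sum_antidiagonal_swap, Finset.Nat.sum_antidiagonal_eq_sum_range_succ_mk]
  rw [Fin.sum_univ_eq_sum_range (fun c => hZ A ((m : ℤ) - (c : ℕ)) * (wpoly A k).coeff c) n]
  have e1 : ∀ L, max (m+1) n = L → ∑ c ∈ Finset.range n, hZ A ((m : ℤ) - (c : ℕ)) * (wpoly A k).coeff c
      = ∑ c ∈ Finset.range L, hZ A ((m : ℤ) - (c : ℕ)) * (wpoly A k).coeff c := by
    rintro L rfl
    refine Finset.sum_subset (by simp) fun c _ hc => ?_
    rw [Finset.mem_range, not_lt] at hc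
    rw [Polynomial.coeff_eq_zero_of_natDegree_lt ((wpoly_natDegree A k).trans_le hc), mul_zero]
  rw [e1 _ rfl]
  have e2 : ∑ c ∈ Finset.range (m+1), hZ A ((m : ℤ) - (c : ℕ)) * (wpoly A k).coeff c
      = ∑ c ∈ Finset.range (max (m+1) n), hZ A ((m : ℤ) - (c : ℕ)) * (wpoly A k).coeff c := by
    refine Finset.sum_subset (by simp) fun c _ hc => ?_
    rw [Finset.mem_range, not_lt] at hc
    rw [hZ, if_neg (by omega), zero_mul]
  rw [← e2]
  refine Finset.sum_congr rfl fun c hc => ?_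
  rw [Finset.mem_range] at hc
  have : ((m : ℤ) - c).toNat = m - c := by omega
  rw [hZ, if_pos (by omega), this]
  simp [Polynomial.coeff_coe]

lemma hh_zero {R : Type*} [CommRing R] {n : ℕ} (A : Fin n → R) : hh A 0 = 1 := by
  simp [hh, Finset.Nat.antidiagonalTuple_zero_right]

/-- matrix of coefficients of `wpoly` -/
noncomputable def wmat {R : Type*} [CommRing R] {n : ℕ} (A : Fin n → R) :
    Matrix (Fin n) (Fin n) R := Matrix.of fun c k => (wpoly A k).coeff c

lemma det_wmat {R : Type*} [CommRing R] {n : ℕ} (A : Fin n → R) :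
    (wmat A).det = (Matrix.vandermonde A).det := by
  have h : (Matrix.vandermonde A).transpose =
      (Matrix.of fun m c : Fin n => hZ A (((m : ℕ) : ℤ) - (c : ℕ))) * wmat A := by
    ext m k
    rw [Matrix.transpose_apply, Matrix.vandermonde_apply, pow_eq_sum, Matrix.mul_apply]
    rfl
  rw [← Matrix.det_transpose (Matrix.vandermonde A), h, Matrix.det_mul,
    Matrix.det_of_isLowerTriangular (Matrix.of _)]
  · simp [hZ, hh_zero]
  · intro i j hij
    have : (i : ℕ) < j := hij
    simp only [Matrix.of_apply, hZ]
    rw [if_neg (by omega)]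

/-- The big Toeplitz block matrix. -/
noncomputable def bigM {R : Type*} [CommRing R] {a b : ℕ} (A : Fin a → R) (B : Fin b → R) :
    Matrix (Fin b ⊕ Fin a) (Fin b ⊕ Fin a) R :=
  Matrix.of fun r c => Sum.elim (fun j : Fin b => hZ B (((finSumFinEquiv r : Fin (b + a)) : ℕ) - (j : ℕ) : ℤ))
    (fun i : Fin a => hZ A (((finSumFinEquiv r : Fin (b + a)) : ℕ) - (i : ℕ) : ℤ)) c

lemma prod_Ioi_add {M : Type*} [CommMonoid M] {a b : ℕ} (f : Fin (b + a) → Fin (b + a) → M) :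
    ∏ x, ∏ y ∈ Finset.Ioi x, f x y =
      (∏ x, ∏ y ∈ Finset.Ioi x, f (Fin.castAdd a x) (Fin.castAdd a y)) *
      (∏ x, ∏ y, f (Fin.castAdd a x) (Fin.natAdd b y)) *
      (∏ x, ∏ y ∈ Finset.Ioi x, f (Fin.natAdd b x) (Fin.natAdd b y)) := by
  have h : ∀ (n : ℕ) (x : Fin n) (g : Fin n → M),
      ∏ y ∈ Finset.Ioi x, g y = ∏ y, if x < y then g y else 1 := by
    intro n x g
    rw [← Finset.prod_filter]
    congr 1; ext; simp
  simp only [h]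
  rw [Fin.prod_univ_add]
  simp only [Fin.prod_univ_add, Finset.prod_mul_distrib]
  have h1 : ∀ (x : Fin a) (y : Fin b), ¬ (Fin.natAdd b x < Fin.castAdd a y) := by
    intro x y; rw [Fin.lt_def]; simp; omega
  have h2 : ∀ (x : Fin a) (y : Fin b), (Fin.castAdd a y < Fin.natAdd b x) := by
    intro x y; rw [Fin.lt_def]; simp; omega
  have h3 : ∀ (x y : Fin b), (Fin.castAdd a x < Fin.castAdd a y) ↔ x < y := by
    intro x y; rw [Fin.lt_def, Fin.lt_def]; rfl
  simp [h1, h2, h3]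

lemma bigM_det {R : Type*} [CommRing R] {a b : ℕ} (A : Fin a → R) (B : Fin b → R) :
    (bigM A B).det * ((Matrix.vandermonde B).det * (Matrix.vandermonde A).det) =
      (∏ j, ∏ i, (A i - B j)) * ((Matrix.vandermonde B).det * (Matrix.vandermonde A).det) := by
  have h : bigM A B * Matrix.fromBlocks (wmat B) 0 0 (wmat A) =
      (Matrix.vandermonde (Fin.append B A)).transpose.submatrix finSumFinEquiv finSumFinEquiv := by
    ext r c
    rw [Matrix.mul_apply, Fintype.sum_sum_type]
    rcases c with c | c
    · simp [bigM, wmat, Matrix.vandermonde_apply, pow_eq_sum B c]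
    · simp [bigM, wmat, Matrix.vandermonde_apply, pow_eq_sum A c]
  have h' := congrArg Matrix.det h
  rw [Matrix.det_mul, Matrix.det_fromBlocks_zero₂₁, det_wmat, det_wmat,
    Matrix.det_submatrix_equiv_self, Matrix.det_transpose, Matrix.det_vandermonde (Fin.append B A),
    prod_Ioi_add] at h'
  rw [h', Matrix.det_vandermonde, Matrix.det_vandermonde]
  simp only [Fin.append_left, Fin.append_right]
  ring

lemma mem_box {a b : ℕ} {α : Fin a → ℕ} :
    α ∈ box a b ↔ (∀ i, α i ≤ b) ∧ ∀ i j : Fin a, i ≤ j → α j ≤ α i := by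
  unfold _root_.box
  rw [Finset.mem_filter, Finset.mem_image]
  refine and_congr_left fun _ => ⟨?_, fun h => ?_⟩
  · rintro ⟨f, _, rfl⟩ i
    have := (f i).isLt
    show (f i : ℕ) ≤ b
    omega
  · exact ⟨fun i => ⟨α i, Nat.lt_succ_of_le (h i)⟩, Finset.mem_univ _, rfl⟩

lemma compTr_rev {a b : ℕ} (α : Fin a → ℕ) (j : Fin b) :
    compTr a b α j.rev = (Finset.univ.filter fun i : Fin a => α i.rev ≤ j).card := by
  unfold compTr tr boxCompl
  congr 1
  ext i
  have := j.isLt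
  simp only [Finset.mem_filter, Finset.mem_univ, true_and, Fin.val_rev]
  omega

lemma lt_compTr_rev {a b : ℕ} {α : Fin a → ℕ} (hα : α ∈ box a b) (i : Fin a) (j : Fin b) :
    (i : ℕ) < compTr a b α j.rev ↔ α i.rev ≤ j := by
  rw [mem_box] at hα
  rw [compTr_rev]
  constructor
  · intro h
    by_contra hc
    have hsub : (Finset.univ.filter fun i : Fin a => α i.rev ≤ j) ⊆ Finset.Iio i := by
      intro k hk
      rw [Finset.mem_filter] at hk
      rw [Finset.mem_Iio]
      by_contra hik
      have := hα.2 k.rev i.rev (Fin.rev_le_rev.mpr (not_lt.mp hik))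
      omega
    have := Finset.card_le_card hsub
    rw [Fin.card_Iio] at this
    omega
  · intro h
    have hsub : Finset.Iic i ⊆ (Finset.univ.filter fun i : Fin a => α i.rev ≤ j) := by
      intro k hk
      rw [Finset.mem_Iic] at hk
      rw [Finset.mem_filter]
      have := hα.2 i.rev k.rev (Fin.rev_le_rev.mpr hk)
      exact ⟨Finset.mem_univ _, by omega⟩
    have := Finset.card_le_card hsub
    rw [Fin.card_Iic] at this
    omega

lemma compTr_le {a b : ℕ} (α : Fin a → ℕ) (j : Fin b) : compTr a b α j ≤ a := by
  unfold compTr tr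
  exact (Finset.card_le_univ _).trans (by simp)

lemma compTr_rev_mono {a b : ℕ} (α : Fin a → ℕ) {j k : Fin b} (h : j ≤ k) :
    compTr a b α j.rev ≤ compTr a b α k.rev := by
  rw [compTr_rev, compTr_rev]
  refine Finset.card_le_card fun i hi => ?_
  rw [Finset.mem_filter] at *
  have : (j : ℕ) ≤ k := h
  exact ⟨hi.1, by omega⟩

/-- rows used by the first Schur polynomial -/
def prow {a b : ℕ} (α : Fin a → ℕ) (hα : α ∈ box a b) (i : Fin a) : Fin (b + a) :=
  ⟨α i.rev + i, by have := (mem_box.1 hα).1 i.rev; omega⟩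

/-- rows used by the second Schur polynomial -/
def qrow {a : ℕ} (b : ℕ) (α : Fin a → ℕ) (j : Fin b) : Fin (b + a) :=
  ⟨compTr a b α j.rev + j, by have := compTr_le α j.rev; omega⟩

lemma prow_strictMono {a b : ℕ} (α : Fin a → ℕ) (hα : α ∈ box a b) : StrictMono (prow α hα) := by
  intro i j hij
  have := (mem_box.1 hα).2 j.rev i.rev (Fin.rev_le_rev.mpr hij.le)
  rw [Fin.lt_def] at *
  simp only [prow]
  omega

lemma qrow_strictMono {a : ℕ} (b : ℕ) (α : Fin a → ℕ) : StrictMono (qrow b α) := by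
  intro i j hij
  have := compTr_rev_mono α hij.le
  rw [Fin.lt_def] at *
  simp only [qrow]
  omega

lemma qrow_lt_prow {a b : ℕ} (α : Fin a → ℕ) (hα : α ∈ box a b) (i : Fin a) (j : Fin b) :
    qrow b α j < prow α hα i ↔ ¬ α i.rev ≤ j := by
  have := lt_compTr_rev hα i j
  rw [Fin.lt_def]
  simp only [qrow, prow]
  omega

lemma qrow_ne_prow {a b : ℕ} (α : Fin a → ℕ) (hα : α ∈ box a b) (i : Fin a) (j : Fin b) :
    qrow b α j ≠ prow α hα i := by
  have := lt_compTr_rev hα i j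
  rw [Ne, Fin.ext_iff]
  simp only [qrow, prow]
  omega

lemma rows_injective {a b : ℕ} (α : Fin a → ℕ) (hα : α ∈ box a b) :
    Function.Injective (Sum.elim (qrow b α) (prow α hα)) :=
  (qrow_strictMono b α).injective.sumElim (prow_strictMono α hα).injective
    (fun j i => qrow_ne_prow α hα i j)

/-- The shuffle attached to a partition. -/
noncomputable def shuf {a b : ℕ} (α : Fin a → ℕ) (hα : α ∈ box a b) :
    Equiv.Perm (Fin b ⊕ Fin a) :=
  Equiv.ofBijective (fun x => finSumFinEquiv.symm (Sum.elim (qrow b α) (prow α hα) x))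
    (Finite.injective_iff_bijective.1
      (finSumFinEquiv.symm.injective.comp (rows_injective α hα)))

lemma fsf_shuf {a b : ℕ} (α : Fin a → ℕ) (hα : α ∈ box a b) (x : Fin b ⊕ Fin a) :
    finSumFinEquiv (shuf α hα x) = Sum.elim (qrow b α) (prow α hα) x := by
  simp [shuf]

lemma wt_compTr {a b : ℕ} (α : Fin a → ℕ) :
    wt (compTr a b α) = ∑ j : Fin b, compTr a b α j.rev := by
  unfold wt
  exact (Equiv.sum_comp Fin.revPerm (compTr a b α)).symm

lemma sign_shuf {a b : ℕ} (α : Fin a → ℕ) (hα : α ∈ box a b) :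
    Equiv.Perm.sign (shuf α hα) = (-1) ^ wt (compTr a b α) := by
  rw [← Equiv.Perm.sign_permCongr finSumFinEquiv, Equiv.Perm.sign_eq_prod_prod_Ioi, prod_Ioi_add]
  simp only [Equiv.permCongr_apply, finSumFinEquiv_symm_apply_castAdd,
    finSumFinEquiv_symm_apply_natAdd, fsf_shuf, Sum.elim_inl, Sum.elim_inr]
  rw [Finset.prod_eq_one, Finset.prod_eq_one (s := Finset.univ)
    (f := fun x : Fin a => ∏ y ∈ Finset.Ioi x, if prow α hα x < prow α hα y then (1 : ℤˣ) else -1)]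
  · rw [one_mul, mul_one, wt_compTr, ← Finset.prod_pow_eq_pow_sum]
    refine Finset.prod_congr rfl fun j _ => ?_
    simp only [qrow_lt_prow]
    rw [compTr_rev, Finset.prod_ite, Finset.prod_const_one, one_mul, Finset.prod_const]
    simp
  · intro x _
    refine Finset.prod_eq_one fun y hy => if_pos (prow_strictMono α hα (Finset.mem_Ioi.1 hy))
  · intro x _
    refine Finset.prod_eq_one fun y hy => if_pos (qrow_strictMono b α (Finset.mem_Ioi.1 hy))

lemma schur_eq_p {R : Type*} [CommRing R] {a b n : ℕ} (A : Fin n → R) (α : Fin a → ℕ)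
    (hα : α ∈ box a b) :
    schur A α = Matrix.det (Matrix.of fun i j : Fin a =>
      hZ A (((prow α hα i : ℕ) : ℤ) - (j : ℕ))) := by
  rw [schur, ← Matrix.det_submatrix_equiv_self Fin.revPerm]
  congr 1
  ext i j
  have := i.isLt
  have := j.isLt
  simp only [Matrix.submatrix_apply, Matrix.of_apply, prow, Fin.revPerm_apply, Fin.val_rev]
  congr 1
  omega

lemma schur_eq_q {R : Type*} [CommRing R] {a b n : ℕ} (B : Fin n → R) (α : Fin a → ℕ) :
    schur B (compTr a b α) = Matrix.det (Matrix.of fun i j : Fin b =>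
      hZ B (((qrow b α i : ℕ) : ℤ) - (j : ℕ))) := by
  rw [schur, ← Matrix.det_submatrix_equiv_self Fin.revPerm]
  congr 1
  ext i j
  have := i.isLt
  have := j.isLt
  simp only [Matrix.submatrix_apply, Matrix.of_apply, qrow, Fin.revPerm_apply, Fin.val_rev]
  congr 1
  omega

lemma shuf_inj {a b : ℕ} {α α' : Fin a → ℕ} (hα : α ∈ box a b) (hα' : α' ∈ box a b)
    {ρ ρ' : Equiv.Perm (Fin b) × Equiv.Perm (Fin a)}
    (h : shuf α hα * Equiv.Perm.sumCongrHom _ _ ρ = shuf α' hα' * Equiv.Perm.sumCongrHom _ _ ρ') :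
    α = α' ∧ ρ = ρ' := by
  have hr : ∀ (β : Fin a → ℕ) (hβ : β ∈ box a b) (ρ : Equiv.Perm (Fin b) × Equiv.Perm (Fin a)),
      Set.range (prow β hβ) = Set.range (fun i : Fin a =>
        finSumFinEquiv ((shuf β hβ * Equiv.Perm.sumCongrHom _ _ ρ) (Sum.inr i))) := by
    intro β hβ ρ
    simp only [Equiv.Perm.mul_apply, fsf_shuf]
    exact (ρ.2.surjective.range_comp (prow β hβ)).symm
  have h1 : Set.range (prow α hα) = Set.range (prow α' hα') := by
    rw [hr α hα ρ, hr α' hα' ρ', h]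
  rw [(prow_strictMono α hα).range_inj (prow_strictMono α' hα')] at h1
  have h2 : α = α' := by
    funext i
    have := congrArg Fin.val (congrFun h1 i.rev)
    simp only [prow, Fin.rev_rev] at this
    omega
  subst h2
  exact ⟨rfl, Equiv.Perm.sumCongrHom_injective (mul_left_cancel h)⟩

lemma shuf_surj {a b : ℕ} (σ : Equiv.Perm (Fin b ⊕ Fin a)) :
    ∃ (α : Fin a → ℕ) (hα : α ∈ box a b) (ρ : Equiv.Perm (Fin b) × Equiv.Perm (Fin a)),
      shuf α hα * Equiv.Perm.sumCongrHom _ _ ρ = σ := by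
  classical
  have hinj : Function.Injective (fun i : Fin a => finSumFinEquiv (σ (Sum.inr i))) :=
    fun i j h => Sum.inr_injective (σ.injective (finSumFinEquiv.injective h))
  set s : Finset (Fin (b + a)) := Finset.univ.image (fun i : Fin a => finSumFinEquiv (σ (Sum.inr i)))
    with hs
  have hc : s.card = a := by rw [hs, Finset.card_image_of_injective _ hinj]; simp
  set p := s.orderEmbOfFin hc with hp
  have hlt : ∀ i j : Fin a, i ≤ j → (p i : ℕ) + (j - i : ℕ) ≤ p j := by
    intro i j
    obtain ⟨j, hj⟩ := j
    induction j with
    | zero =>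
      intro h
      have : i = ⟨0, hj⟩ := Fin.ext (by simpa [Fin.le_def] using h)
      subst this; simp
    | succ j ih =>
      intro h
      rcases h.eq_or_lt with h | h
      · subst h; simp
      · have h' : (i : ℕ) < j + 1 := h
        have h1 := ih (by omega) (by rw [Fin.le_def]; simp; omega)
        have h2 : p ⟨j, by omega⟩ < p ⟨j+1, hj⟩ := p.strictMono (by rw [Fin.lt_def]; simp)
        rw [Fin.lt_def] at h2
        simp only at h1 ⊢
        omega
  have hge : ∀ i : Fin a, (i : ℕ) ≤ p i := by
    intro i
    have := hlt ⟨0, i.pos⟩ i (by rw [Fin.le_def]; simp)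
    simp only at this
    omega
  let α : Fin a → ℕ := fun i => (p i.rev : ℕ) - (i.rev : ℕ)
  have hα : α ∈ box a b := by
    rw [mem_box]
    constructor
    · intro i
      have h0 := i.pos
      have h1 := hlt i.rev ⟨a - 1, by omega⟩ (by rw [Fin.le_def, Fin.val_rev]; simp; omega)
      have h2 := (p ⟨a - 1, by omega⟩).isLt
      have h3 := i.rev.isLt
      simp only [α] at h1 ⊢
      omega
    · intro i j hij
      have h1 := hlt j.rev i.rev (Fin.rev_le_rev.mpr hij)
      have h2 : (j.rev : ℕ) ≤ i.rev := Fin.rev_le_rev.mpr hij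
      simp only [α]
      omega
  have hpp : ∀ i, prow α hα i = p i := by
    intro i
    have := hge i
    apply Fin.ext
    simp only [prow, α, Fin.rev_rev]
    omega
  have hmem : (shuf α hα)⁻¹ * σ ∈ (Equiv.Perm.sumCongrHom (Fin b) (Fin a)).range := by
    apply Equiv.Perm.mem_sumCongrHom_range_of_perm_mapsTo_inl
    rintro _ ⟨j, rfl⟩
    rcases hx : ((shuf α hα)⁻¹ * σ) (Sum.inl j) with k | k
    · exact ⟨k, rfl⟩
    · exfalso
      rw [Equiv.Perm.mul_apply, Equiv.Perm.inv_eq_iff_eq] at hx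
      have h1 := congrArg finSumFinEquiv hx
      rw [fsf_shuf, Sum.elim_inr, hpp] at h1
      have h2 : p k ∈ s := Finset.orderEmbOfFin_mem s hc k
      rw [← h1, hs, Finset.mem_image] at h2
      obtain ⟨i, _, hi⟩ := h2
      exact absurd (σ.injective (finSumFinEquiv.injective hi)) (by simp)
  obtain ⟨ρ, hρ⟩ := hmem
  exact ⟨α, hα, ρ, by rw [hρ, mul_inv_cancel_left]⟩

lemma det_bigM {R : Type*} [CommRing R] {a b : ℕ} (A : Fin a → R) (B : Fin b → R) :
    (bigM A B).det = ∑ α ∈ box a b, (-1 : R) ^ wt (compTr a b α) * schur A α *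
      schur B (compTr a b α) := by
  rw [Matrix.det_apply', ← Finset.sum_attach (box a b)]
  have hterm : ∀ α : {x // x ∈ box a b},
      (-1 : R) ^ wt (compTr a b α.1) * schur A α.1 * schur B (compTr a b α.1) =
      ∑ ρ : Equiv.Perm (Fin b) × Equiv.Perm (Fin a),
        ((Equiv.Perm.sign (shuf α.1 α.2 * Equiv.Perm.sumCongrHom _ _ ρ) : ℤ) : R) *
        ∏ c, bigM A B ((shuf α.1 α.2 * Equiv.Perm.sumCongrHom _ _ ρ) c) c := by
    rintro ⟨α, hα⟩
    rw [schur_eq_p A α hα, schur_eq_q, Matrix.det_apply', Matrix.det_apply', mul_assoc,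
      mul_comm (Finset.sum _ _) (Finset.sum _ _), Finset.sum_mul_sum, Fintype.sum_prod_type,
      Finset.mul_sum]
    refine Finset.sum_congr rfl fun ρ₁ _ => ?_
    rw [Finset.mul_sum]
    refine Finset.sum_congr rfl fun ρ₂ _ => ?_
    rw [Equiv.Perm.sign_mul, sign_shuf, Equiv.Perm.sumCongrHom_apply, Equiv.Perm.sign_sumCongr,
      Fintype.prod_sum_type]
    simp only [bigM, Matrix.of_apply, Equiv.Perm.mul_apply, fsf_shuf, Equiv.Perm.sumCongr_apply,
      Sum.map_inl, Sum.map_inr, Sum.elim_inl, Sum.elim_inr]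
    push_cast
    ring
  rw [Finset.sum_congr rfl fun α _ => hterm α, ← Finset.sum_product']
  symm
  refine Finset.sum_bij (fun x _ => shuf x.1.1 x.1.2 * Equiv.Perm.sumCongrHom _ _ x.2) ?_ ?_ ?_ ?_
  · intros; exact Finset.mem_univ _
  · rintro ⟨⟨α, hα⟩, ρ⟩ _ ⟨⟨α', hα'⟩, ρ'⟩ _ h
    obtain ⟨h1, h2⟩ := shuf_inj hα hα' h
    subst h1 h2
    rfl
  · intro σ _
    obtain ⟨α, hα, ρ, h⟩ := shuf_surj σ
    exact ⟨⟨⟨α, hα⟩, ρ⟩, by simp, h⟩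
  · intros; rfl

lemma main_sum {R : Type*} [CommRing R] [IsDomain R] {a b : ℕ} (A : Fin a → R) (B : Fin b → R)
    (hA : Function.Injective A) (hB : Function.Injective B) :
    ∑ α ∈ box a b, (-1 : R) ^ wt (compTr a b α) * schur A α * schur B (compTr a b α) =
      ∏ j, ∏ i, (A i - B j) := by
  rw [← det_bigM]
  exact mul_right_cancel₀ (mul_ne_zero (Matrix.det_vandermonde_ne_zero_iff.2 hB)
    (Matrix.det_vandermonde_ne_zero_iff.2 hA)) (bigM_det A B)

lemma ftuple_injective {α : Type*} (A : Finset α) : Function.Injective (ftuple A) :=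
  Subtype.val_injective.comp A.equivFin.symm.injective

lemma prod_ftuple {α M : Type*} [CommMonoid M] (A : Finset α) (f : α → M) :
    ∏ i, f (ftuple A i) = ∏ x ∈ A, f x := by
  rw [← Finset.prod_coe_sort A f]
  exact Equiv.prod_comp A.equivFin.symm (fun x : A => f x)

/-- for a set `Σ` of `N` pairwise distinct complex numbers and a subset
`A ⊆ Σ` with `|A| = a`, one has `θ_{A,Σ∖A} = Π_{λ∈A, μ∈Σ∖A} (λ − μ)`;
in particular `θ_{A,Σ∖A} ≠ 0`. -/
theorem statement4 (N a : ℕ) (S A : Finset ℂ) (hS : S.card = N) (hAS : A ⊆ S)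
    (hA : A.card = a) :
    theta N a S A = (∏ l ∈ A, ∏ m ∈ S \ A, (l - m)) ∧ theta N a S A ≠ 0 := by
  have hb : N - a = (S \ A).card := by
    rw [Finset.card_sdiff_of_subset hAS, hS, hA]
  have key : theta N a S A = ∏ l ∈ A, ∏ m ∈ S \ A, (l - m) := by
    unfold theta
    rw [hb]
    subst hA
    rw [main_sum (ftuple A) (ftuple (S \ A)) (ftuple_injective _) (ftuple_injective _),
      Finset.prod_comm]
    rw [prod_ftuple A (fun l => ∏ j, (l - ftuple (S \ A) j))]
    exact Finset.prod_congr rfl fun l _ => prod_ftuple (S \ A) (fun m => l - m)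
  refine ⟨key, ?_⟩
  rw [key]
  refine Finset.prod_ne_zero_iff.2 fun l hl => Finset.prod_ne_zero_iff.2 fun m hm => ?_
  rw [Finset.mem_sdiff] at hm
  intro h
  rw [sub_eq_zero] at h
  exact hm.2 (h ▸ hl)
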